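/- Let G be a graph with K vertices (given by a symmetric 0-1 adjacency matrix) and let 1 ≤ N ≤ K. If 0 < λ_N^1(G) < 1, then θ_N(G) − Nμ(G) ≤ λ_N^1(G)·2(K²+1)/(2 − λ_N^1(G)); in particular, θ_N(G) − Nμ(G) ≤ 4K²·λ_N^1(G). -/

import Mathlib

namespace BH

variable {V : Type*} [Fintype V] [DecidableEq V]

/-- The operator `M` acting on the `w`-th factor of the `N`-fold tensor power
`(ℂ^V)^{⊗N}`, the latter identified with `ℂ^{V^N}`. -/
noncomputable def onFactor (N : ℕ) (M : Matrix V V ℂ) (w : Fin N) :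
    Matrix (Fin N → V) (Fin N → V) ℂ :=
  Matrix.of fun x y =>
    (if ∀ u, u ≠ w → x u = y u then (1 : ℂ) else 0) * M (x w) (y w)

/-- The Bose–Hubbard interaction term
`Σ_{k ∈ V} Σ_{w ≠ w'} (|k⟩⟨k|)^{(w)} (|k⟩⟨k|)^{(w')}`, a diagonal matrix whose diagonal
entry at a configuration `x : Fin N → V` counts the ordered pairs of distinct particles
sitting at a common vertex. -/
noncomputable def interaction (V : Type*) [DecidableEq V] (N : ℕ) :
    Matrix (Fin N → V) (Fin N → V) ℂ :=
  Matrix.of fun x y =>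
    if x = y then
      (((Finset.univ : Finset (Fin N × Fin N)).filter
          fun p => p.1 ≠ p.2 ∧ x p.1 = x p.2).card : ℂ)
    else 0

/-- The `N`-particle Bose–Hubbard Hamiltonian `H_G^N` (with hopping and interaction
strengths equal to `1`) for the graph with adjacency matrix `A`. -/
noncomputable def bhHam (A : Matrix V V ℂ) (N : ℕ) :
    Matrix (Fin N → V) (Fin N → V) ℂ :=
  (∑ w : Fin N, onFactor N A w) + interaction V N

/-- The bosonic (symmetric) subspace `Z_N(G)`: states invariant under every permutation
of the `N` tensor factors. -/
def symmStates (V : Type*) (N : ℕ) : Set ((Fin N → V) → ℂ) :=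
  { ψ | ∀ σ : Equiv.Perm (Fin N), ∀ x : Fin N → V, ψ (x ∘ σ) = ψ x }

/-- The ground energy (smallest eigenvalue) of the compression of a Hermitian matrix `H`
to a subspace given as a set `Z` of states: the infimum of the Rayleigh quotients
`⟨ψ, H ψ⟩` over unit vectors `ψ ∈ Z`. -/
noncomputable def groundEnergy {ι : Type*} [Fintype ι]
    (H : Matrix ι ι ℂ) (Z : Set (ι → ℂ)) : ℝ :=
  sInf { r : ℝ | ∃ ψ ∈ Z, dotProduct (star ψ) ψ = 1 ∧
    r = (dotProduct (star ψ) (H.mulVec ψ)).re }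

/-- `μ(G)`: the smallest eigenvalue of the adjacency matrix `A = A(G)`. -/
noncomputable def mu (A : Matrix V V ℂ) : ℝ :=
  groundEnergy A Set.univ

/-- `λ_N^1(G)`: the smallest eigenvalue of `H(G,N)`, the restriction of
`H_G^N − N μ(G)·1` to the symmetric subspace `Z_N(G)`. -/
noncomputable def lambda1 (A : Matrix V V ℂ) (N : ℕ) : ℝ :=
  groundEnergy (bhHam A N - ((N : ℂ) * (mu A : ℂ)) • 1) (symmStates V N)

end BH

namespace BH

open scoped Classical

variable {V : Type*} [Fintype V] [DecidableEq V]

/-- The hopping term `|01⟩⟨10| + |10⟩⟨01|` on the pair of qubits `(i,j)` (in one ordered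
orientation; summing over both ordered pairs `(i,j)` and `(j,i)` yields the full
symmetric hopping term of the unordered pair `{i,j}`). -/
noncomputable def xyHop (V : Type*) [DecidableEq V] (i j : V) :
    Matrix (V → Fin 2) (V → Fin 2) ℂ :=
  Matrix.of fun x y =>
    if x i = 1 ∧ x j = 0 ∧ y i = 0 ∧ y j = 1 ∧ (∀ u, u ≠ i → u ≠ j → x u = y u)
    then 1 else 0

/-- The XY Hamiltonian
`O_G = Σ_{{i,j} : i≠j, A i j = 1} (|01⟩⟨10| + |10⟩⟨01|)_{ij} + Σ_{i : A i i = 1} (|1⟩⟨1|)_i`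
on the `V`-qubit space `(ℂ²)^{⊗V}`. -/
noncomputable def xyHam (A : Matrix V V ℂ) : Matrix (V → Fin 2) (V → Fin 2) ℂ :=
  (∑ p : V × V, if p.1 ≠ p.2 ∧ A p.1 p.2 = 1 then xyHop V p.1 p.2 else 0)
    + Matrix.of fun x y =>
        if x = y then
          ((Finset.univ.filter fun i : V => A i i = 1 ∧ x i = 1).card : ℂ)
        else 0

/-- The magnetization-`N` sector `Wt_N(G)`: the span of the computational basis states
with exactly `N` qubits in state `|1⟩`. -/
def wtStates (V : Type*) [Fintype V] [DecidableEq V] (N : ℕ) :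
    Set ((V → Fin 2) → ℂ) :=
  { ψ | ∀ x : V → Fin 2, (Finset.univ.filter fun i => x i = 1).card ≠ N → ψ x = 0 }

/-- `θ_N(G)`: the smallest eigenvalue of the XY Hamiltonian `O_G` restricted to the
magnetization-`N` sector. -/
noncomputable def theta (A : Matrix V V ℂ) (N : ℕ) : ℝ :=
  groundEnergy (xyHam A) (wtStates V N)

end BH

namespace BH
open Matrix
set_option linter.unusedSectionVars false

noncomputable def En {ι : Type*} [Fintype ι] (H : Matrix ι ι ℂ) (v : ι → ℂ) : ℝ :=
  (dotProduct (star v) (H.mulVec v)).re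

noncomputable def nsq {ι : Type*} [Fintype ι] (v : ι → ℂ) : ℝ := ∑ i, ‖v i‖ ^ 2

theorem dot_self {ι : Type*} [Fintype ι] (v : ι → ℂ) :
    dotProduct (star v) v = (nsq v : ℂ) := by
  simp only [dotProduct, nsq, Pi.star_apply, RCLike.star_def]
  push_cast
  exact Finset.sum_congr rfl fun i _ => Complex.conj_mul' (v i)

theorem nsq_nonneg {ι : Type*} [Fintype ι] (v : ι → ℂ) : 0 ≤ nsq v :=
  Finset.sum_nonneg fun _ _ => by positivity

theorem En_bound {ι : Type*} [Fintype ι] (H : Matrix ι ι ℂ) (c : ℝ)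
    (hc : ∀ i j, ‖H i j‖ ≤ c) (v : ι → ℂ) :
    |En H v| ≤ c * Fintype.card ι * nsq v := by
  have h1 : |En H v| ≤ ‖dotProduct (star v) (H.mulVec v)‖ := Complex.abs_re_le_norm _
  refine h1.trans ?_
  simp only [dotProduct, mulVec, Finset.mul_sum, Pi.star_apply]
  calc ‖∑ i, ∑ j, star (v i) * (H i j * v j)‖
      ≤ ∑ i, ∑ j, c * ((‖v i‖ ^ 2 + ‖v j‖ ^ 2) / 2) := by
        refine (norm_sum_le _ _).trans (Finset.sum_le_sum fun i _ => ?_)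
        refine (norm_sum_le _ _).trans (Finset.sum_le_sum fun j _ => ?_)
        rw [norm_mul, norm_mul, norm_star]
        have hc0 : 0 ≤ c := (norm_nonneg _).trans (hc i j)
        calc ‖v i‖ * (‖H i j‖ * ‖v j‖) = ‖H i j‖ * (‖v i‖ * ‖v j‖) := by ring
          _ ≤ c * (‖v i‖ * ‖v j‖) := by gcongr; exact hc i j
          _ ≤ _ := by
            gcongr
            nlinarith [sq_nonneg (‖v i‖ - ‖v j‖)]
    _ = c * Fintype.card ι * nsq v := by
        simp only [← Finset.mul_sum, ← Finset.sum_div, Finset.sum_add_distrib,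
          Finset.sum_const, nsq, Finset.card_univ, nsmul_eq_mul]
        ring

theorem En_smul {ι : Type*} [Fintype ι] (H : Matrix ι ι ℂ) (a : ℝ) (v : ι → ℂ) :
    En H ((a : ℂ) • v) = a ^ 2 * En H v := by
  unfold En
  rw [mulVec_smul, star_smul, dotProduct_smul, smul_dotProduct]
  simp [sq, mul_assoc]

theorem nsq_smul {ι : Type*} [Fintype ι] (a : ℝ) (v : ι → ℂ) :
    nsq ((a : ℂ) • v) = a ^ 2 * nsq v := by
  simp [nsq, Finset.mul_sum, mul_pow]

theorem En_comb {ι : Type*} [Fintype ι] (H : Matrix ι ι ℂ) (v w : ι → ℂ) :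
    ∃ B : ℝ, ∀ a b : ℝ, En H ((a : ℂ) • v + (b : ℂ) • w)
      = a ^ 2 * En H v + b ^ 2 * En H w + a * b * B := by
  refine ⟨(dotProduct (star v) (H.mulVec w)).re + (dotProduct (star w) (H.mulVec v)).re, ?_⟩
  intro a b
  unfold En
  simp only [mulVec_add, mulVec_smul, star_add, star_smul, dotProduct_smul, smul_dotProduct,
    add_dotProduct, dotProduct_add]
  simp
  ring

/-- convexity-type inequality for positive semidefinite forms -/
theorem En_sub_le {ι : Type*} [Fintype ι] (H : Matrix ι ι ℂ) (hH : ∀ v, 0 ≤ En H v)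
    (v w : ι → ℂ) (c : ℝ) (hc : 0 < c) :
    En H (v - w) ≤ (1 + c) * En H v + (1 + 1 / c) * En H w := by
  obtain ⟨B, hB⟩ := En_comb H v w
  have h1 := hB 1 (-1)
  have h2 := hH ((c : ℂ) • v + ((1 : ℝ) : ℂ) • w)
  rw [hB] at h2
  have e : (((1 : ℝ) : ℂ) • v + ((-1 : ℝ) : ℂ) • w) = v - w := by
    simp [sub_eq_add_neg]
  rw [e] at h1
  rw [h1]
  have h3 : 0 ≤ (c ^ 2 * En H v + 1 ^ 2 * En H w + c * 1 * B) / c := div_nonneg h2 hc.le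
  have h4 : (c ^ 2 * En H v + 1 ^ 2 * En H w + c * 1 * B) / c
     = c * En H v + 1 / c * En H w + B := by field_simp
  rw [h4] at h3
  linarith

theorem ground_le {ι : Type*} [Fintype ι] (H : Matrix ι ι ℂ) (Z : Set (ι → ℂ))
    (hZ : ∀ (a : ℝ) (v), v ∈ Z → (a : ℂ) • v ∈ Z) (v : ι → ℂ) (hv : v ∈ Z) :
    groundEnergy H Z * nsq v ≤ En H v := by
  obtain ⟨c, hc⟩ : ∃ c : ℝ, ∀ i j, ‖H i j‖ ≤ c := by
    refine ⟨∑ i, ∑ j, ‖H i j‖, fun i j => ?_⟩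
    refine le_trans ?_ (Finset.single_le_sum (f := fun i => ∑ j, ‖H i j‖)
      (fun _ _ => Finset.sum_nonneg fun _ _ => norm_nonneg _) (Finset.mem_univ i))
    exact Finset.single_le_sum (f := fun j => ‖H i j‖) (fun _ _ => norm_nonneg _)
      (Finset.mem_univ j)
  rcases (nsq_nonneg v).eq_or_lt with h0 | h0
  · have := En_bound H c hc v
    rw [← h0] at this ⊢
    simp only [mul_zero] at this ⊢
    linarith [(abs_le.1 this).1]
  · have hb : BddBelow { r : ℝ | ∃ ψ ∈ Z, dotProduct (star ψ) ψ = 1 ∧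
        r = (dotProduct (star ψ) (H.mulVec ψ)).re } := by
      refine ⟨-(c * Fintype.card ι), ?_⟩
      rintro r ⟨ψ, _, h1, rfl⟩
      have := En_bound H c hc ψ
      have e : nsq ψ = 1 := by rw [dot_self] at h1; exact_mod_cast h1
      rw [e, mul_one] at this
      exact (abs_le.1 this).1
    set a : ℝ := 1 / Real.sqrt (nsq v) with ha
    have ha2 : a ^ 2 * nsq v = 1 := by
      rw [ha, div_pow, Real.sq_sqrt h0.le]; field_simp
    have := csInf_le hb (a := En H ((a : ℂ) • v)) ⟨(a : ℂ) • v, hZ a v hv, by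
      rw [dot_self, nsq_smul, ha2]; simp, rfl⟩
    change groundEnergy H Z ≤ _ at this
    rw [En_smul] at this
    calc _ ≤ a ^ 2 * En H v * nsq v := by gcongr
      _ = (a ^ 2 * nsq v) * En H v := by ring
      _ = _ := by rw [ha2, one_mul]

variable {V : Type*} [Fintype V] [DecidableEq V]

theorem onFactor_mulVec (N : ℕ) (M : Matrix V V ℂ) (w : Fin N) (ψ : (Fin N → V) → ℂ)
    (x : Fin N → V) :
    (onFactor N M w).mulVec ψ x = ∑ v, M (x w) v * ψ (Function.update x w v) := by
  have hinj : Function.Injective (fun v => Function.update x w v) := Function.update_injective x w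
  rw [← Finset.sum_image (s := Finset.univ) (g := fun v => Function.update x w v)
    (f := fun y => M (x w) (y w) * ψ y) (fun a _ b _ h => hinj h) |>.trans
    (Finset.sum_congr rfl fun v _ => by simp)]
  simp only [mulVec, dotProduct, onFactor, of_apply]
  symm
  refine Finset.sum_subset_zero_on_sdiff (Finset.subset_univ _) ?_ ?_
  · intro y hy
    have : ¬ ∀ u, u ≠ w → x u = y u := by
      intro h
      simp only [Finset.mem_sdiff, Finset.mem_univ, Finset.mem_image, true_and] at hy
      refine hy ⟨y w, ?_⟩
      ext u
      by_cases hu : u = w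
      · subst hu; simp
      · simp [hu, h u hu]
    simp [this]
  · intro y hy
    simp only [Finset.mem_image, Finset.mem_univ, true_and] at hy
    obtain ⟨v, rfl⟩ := hy
    have : ∀ u, u ≠ w → x u = Function.update x w v u := by
      intro u hu; simp [hu]
    rw [if_pos this]; simp

theorem sum_split (N : ℕ) (w : Fin N) {R : Type*} [AddCommMonoid R] (F : (Fin N → V) → R) :
    ∑ x, F x = ∑ r : ({j // j ≠ w} → V), ∑ a : V, F ((Equiv.funSplitAt w V).symm (a, r)) := by
  rw [← Equiv.sum_comp (Equiv.funSplitAt w V).symm, Fintype.sum_prod_type, Finset.sum_comm]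

theorem upd_split (N : ℕ) (w : Fin N) (r : {j // j ≠ w} → V) (a v : V) :
    Function.update ((Equiv.funSplitAt w V).symm (a, r)) w v
      = (Equiv.funSplitAt w V).symm (v, r) := by
  ext u
  by_cases hu : u = w
  · subst hu; simp
  · simp [hu]

theorem En_onFactor (N : ℕ) (M : Matrix V V ℂ) (w : Fin N) (ψ : (Fin N → V) → ℂ) :
    En (onFactor N M w) ψ = ∑ r : ({j // j ≠ w} → V),
      En M (fun a => ψ ((Equiv.funSplitAt w V).symm (a, r))) := by
  unfold En
  rw [← Complex.re_sum]
  congr 1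
  simp only [dotProduct]
  rw [sum_split N w]
  refine Finset.sum_congr rfl fun r _ => Finset.sum_congr rfl fun a _ => ?_
  rw [onFactor_mulVec]
  simp only [upd_split, Pi.star_apply, mulVec, dotProduct]
  simp

theorem nsq_split (N : ℕ) (w : Fin N) (ψ : (Fin N → V) → ℂ) :
    nsq ψ = ∑ r : ({j // j ≠ w} → V),
      nsq (fun a => ψ ((Equiv.funSplitAt w V).symm (a, r))) := by
  unfold nsq
  rw [sum_split N w]

/-- kinetic term -/
noncomputable def kin (A : Matrix V V ℂ) (N : ℕ) : Matrix (Fin N → V) (Fin N → V) ℂ :=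
  ∑ w : Fin N, onFactor N A w

theorem En_add {ι : Type*} [Fintype ι] (H H' : Matrix ι ι ℂ) (v : ι → ℂ) :
    En (H + H') v = En H v + En H' v := by
  simp [En, add_mulVec, dotProduct_add]

theorem En_sub_smul {ι : Type*} [Fintype ι] [DecidableEq ι] (H : Matrix ι ι ℂ) (c : ℝ)
    (v : ι → ℂ) :
    En (H - (c : ℂ) • 1) v = En H v - c * nsq v := by
  simp [En, sub_mulVec, smul_mulVec, dotProduct_sub, dot_self]

theorem En_kin (A : Matrix V V ℂ) (N : ℕ) (ψ : (Fin N → V) → ℂ) :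
    En (kin A N) ψ = ∑ w : Fin N, En (onFactor N A w) ψ := by
  simp [En, kin, sum_mulVec, dotProduct_sum]

theorem kin_lower (A : Matrix V V ℂ) (N : ℕ) (ψ : (Fin N → V) → ℂ) :
    N * mu A * nsq ψ ≤ En (kin A N) ψ := by
  rw [En_kin]
  have : ∀ w ∈ (Finset.univ : Finset (Fin N)), mu A * nsq ψ ≤ En (onFactor N A w) ψ := by
    intro w _
    rw [En_onFactor, nsq_split N w, Finset.mul_sum]
    exact Finset.sum_le_sum fun r _ => ground_le A _ (fun _ _ _ => Set.mem_univ _) _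
      (Set.mem_univ _)
  have := Finset.sum_le_sum this
  simp only [Finset.sum_const, Finset.card_univ, Fintype.card_fin, nsmul_eq_mul] at this
  linarith

theorem kin_upper (A : Matrix V V ℂ) (h1 : ∀ i j, ‖A i j‖ ≤ 1) (N : ℕ)
    (ψ : (Fin N → V) → ℂ) :
    En (kin A N) ψ ≤ N * Fintype.card V * nsq ψ := by
  rw [En_kin]
  have : ∀ w ∈ (Finset.univ : Finset (Fin N)),
      En (onFactor N A w) ψ ≤ Fintype.card V * nsq ψ := by
    intro w _
    rw [En_onFactor, nsq_split N w, Finset.mul_sum]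
    refine Finset.sum_le_sum fun r _ => ?_
    have := (abs_le.1 (En_bound A 1 h1 (fun a => ψ ((Equiv.funSplitAt w V).symm (a, r))))).2
    linarith
  have := Finset.sum_le_sum this
  simp only [Finset.sum_const, Finset.card_univ, Fintype.card_fin, nsmul_eq_mul] at this
  linarith

theorem mu_lower (A : Matrix V V ℂ) (h1 : ∀ i j, ‖A i j‖ ≤ 1) :
    -(Fintype.card V : ℝ) ≤ mu A := by
  refine Real.le_sInf ?_ (by simp)
  rintro r ⟨ψ, _, hn, rfl⟩
  have := En_bound A 1 h1 ψ
  have e : nsq ψ = 1 := by rw [dot_self] at hn; exact_mod_cast hn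
  rw [e, mul_one, one_mul] at this
  exact (abs_le.1 this).1

theorem En_interaction (N : ℕ) (ψ : (Fin N → V) → ℂ) :
    En (interaction V N) ψ = ∑ x : Fin N → V,
      (((Finset.univ : Finset (Fin N × Fin N)).filter
          fun p => p.1 ≠ p.2 ∧ x p.1 = x p.2).card : ℝ) * ‖ψ x‖ ^ 2 := by
  unfold En
  simp only [dotProduct, mulVec, interaction, of_apply, ite_mul, zero_mul,
    Finset.sum_ite_eq, Finset.mem_univ, if_true, Complex.re_sum, Pi.star_apply]
  refine Finset.sum_congr rfl fun x _ => ?_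
  have : star (ψ x) * ψ x = ((‖ψ x‖ ^ 2 : ℝ) : ℂ) := by
    rw [RCLike.star_def, Complex.conj_mul']; simp
  rw [mul_left_comm, this]
  norm_cast

theorem two_le_card (N : ℕ) (x : Fin N → V) (hx : ¬ Function.Injective x) :
    2 ≤ ((Finset.univ : Finset (Fin N × Fin N)).filter
          fun p => p.1 ≠ p.2 ∧ x p.1 = x p.2).card := by
  simp only [Function.Injective, not_forall] at hx
  obtain ⟨a, b, hab, hne⟩ := hx
  have : ({(a, b), (b, a)} : Finset (Fin N × Fin N)) ⊆ (Finset.univ.filter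
          fun p => p.1 ≠ p.2 ∧ x p.1 = x p.2) := by
    intro p hp
    simp only [Finset.mem_insert, Finset.mem_singleton] at hp
    rcases hp with rfl | rfl
    · simp [hne, hab]
    · simp [hab, Ne.symm hne]
  calc 2 = ({(a, b), (b, a)} : Finset (Fin N × Fin N)).card := by
        rw [Finset.card_pair]; simp [hne]
    _ ≤ _ := Finset.card_le_card this

/-- occupation numbers -/
noncomputable def occ {N : ℕ} (x : Fin N → V) : V → Fin 2 :=
  fun i => if i ∈ Finset.univ.image x then 1 else 0

theorem occ_eq_one {N : ℕ} (x : Fin N → V) (i : V) : occ x i = 1 ↔ ∃ w, x w = i := by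
  unfold occ; split_ifs with h <;> simpa using h

theorem occ_eq_zero {N : ℕ} (x : Fin N → V) (i : V) : occ x i = 0 ↔ ∀ w, x w ≠ i := by
  unfold occ; split_ifs with h <;> simpa using h

theorem occ_card {N : ℕ} (x : Fin N → V) (hx : Function.Injective x) :
    (Finset.univ.filter fun i => occ x i = 1).card = N := by
  have : (Finset.univ.filter fun i => occ x i = 1) = Finset.univ.image x := by
    ext i; simp [occ_eq_one]
  rw [this, Finset.card_image_of_injective _ hx]; simp

theorem occ_perm {N : ℕ} (x y : Fin N → V) (hx : Function.Injective x)
    (hy : Function.Injective y) (h : occ x = occ y) : ∃ σ : Equiv.Perm (Fin N), y = x ∘ σ := by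
  have hr : ∀ i, ∃ w, x w = y i := fun i => by
    rw [← occ_eq_one, h, occ_eq_one]; exact ⟨i, rfl⟩
  choose σ hσ using hr
  have hinj : Function.Injective σ := fun a b hab => hy (by rw [← hσ, ← hσ, hab])
  exact ⟨Equiv.ofBijective σ (Finite.injective_iff_bijective.1 hinj),
    funext fun i => (hσ i).symm⟩

theorem exists_f {N : ℕ} (ψ : (Fin N → V) → ℂ) (hψ : ψ ∈ symmStates V N) :
    ∃ f ∈ wtStates V N, ∀ x : Fin N → V, Function.Injective x → ψ x = f (occ x) := by
  classical
  refine ⟨fun s => if h : ∃ x : Fin N → V, Function.Injective x ∧ occ x = s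
    then ψ h.choose else 0, ?_, ?_⟩
  · intro s hs
    dsimp only
    rw [dif_neg]
    rintro ⟨x, hx, rfl⟩
    refine hs ?_
    convert occ_card x hx
  · intro x hx
    have h : ∃ y : Fin N → V, Function.Injective y ∧ occ y = occ x := ⟨x, hx, rfl⟩
    dsimp only
    rw [dif_pos h]
    obtain ⟨σ, hσ⟩ := occ_perm x h.choose hx h.choose_spec.1 h.choose_spec.2.symm
    rw [hσ, hψ]

theorem fiber_card {N : ℕ} (s : V → Fin 2) 
    (hs : (Finset.univ.filter fun i => s i = 1).card = N) :
    Fintype.card {x : Fin N → V // Function.Injective x ∧ occ x = s} = N.factorial := by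
  have hc : Fintype.card {i // s i = 1} = N := by rw [Fintype.card_subtype]; exact hs
  have e0 : Fin N ≃ {i // s i = 1} := (Fintype.equivFinOfCardEq hc).symm
  have e : (Fin N ≃ {i // s i = 1}) ≃ {x : Fin N → V // Function.Injective x ∧ occ x = s} :=
    { toFun := fun g => ⟨fun w => (g w : V), fun a b h => g.injective (Subtype.ext h), by
        ext i
        by_cases hi : s i = 1
        · rw [hi, (occ_eq_one _ _).2 ⟨g.symm ⟨i, hi⟩, by simp⟩]
        · have : s i = 0 := by omega
          rw [this, (occ_eq_zero _ _).2]
          intro w hw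
          exact hi (hw ▸ (g w).2)⟩
      invFun := fun x => Equiv.ofBijective
        (fun w => (⟨x.1 w, (congrFun x.2.2 (x.1 w)).symm.trans ((occ_eq_one _ _).2 ⟨w, rfl⟩)⟩ : {i // s i = 1}))
        ⟨fun a b h => x.2.1 (congrArg Subtype.val h), fun i => by
          obtain ⟨w, hw⟩ := (occ_eq_one _ _).1 ((congrFun x.2.2 i.1).trans i.2)
          exact ⟨w, Subtype.ext hw⟩⟩
      left_inv := fun g => by ext w; rfl
      right_inv := fun x => by ext w; rfl }
  rw [← Fintype.card_congr e, Fintype.card_equiv e0, Fintype.card_fin]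

open scoped Classical in
theorem sum_inj {N : ℕ} {R : Type*} [CommSemiring R] (g : (V → Fin 2) → R)
    (hg : ∀ s, (Finset.univ.filter fun i => s i = 1).card ≠ N → g s = 0) :
    ∑ x : Fin N → V, (if Function.Injective x then g (occ x) else 0)
      = (N.factorial : R) * ∑ s, g s := by
  rw [← Finset.sum_fiberwise (s := Finset.univ) (g := fun x : Fin N → V => occ x), Finset.mul_sum]
  refine Finset.sum_congr rfl fun s _ => ?_
  have : ∀ x ∈ Finset.univ.filter (fun x : Fin N → V => occ x = s),
      (if Function.Injective x then g (occ x) else 0)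
        = if Function.Injective x then g s else 0 := by
    intro x hx
    rw [(Finset.mem_filter.1 hx).2]
  rw [Finset.sum_congr rfl this, ← Finset.sum_filter, Finset.sum_const, nsmul_eq_mul]
  by_cases h : (Finset.univ.filter fun i => s i = 1).card = N
  · congr 2
    rw [← fiber_card s h, Fintype.card_subtype, Finset.filter_filter]
    congr 1
    ext x; simp [and_comm]
  · rw [hg s h]; simp

theorem xyHop_mulVec (i j : V) (hij : i ≠ j) (f : (V → Fin 2) → ℂ) (s : V → Fin 2) :
    (xyHop V i j).mulVec f s = if s i = 1 ∧ s j = 0 then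
      f (Function.update (Function.update s i 0) j 1) else 0 := by
  simp only [mulVec, dotProduct, xyHop, of_apply]
  rw [Finset.sum_eq_single (Function.update (Function.update s i 0) j 1)]
  · by_cases h : s i = 1 ∧ s j = 0
    · rw [if_pos h, if_pos, one_mul]
      refine ⟨h.1, h.2, by simp [hij], by simp, ?_⟩
      intro u hu hu'; simp [hu, hu']
    · rw [if_neg h, if_neg, zero_mul]
      rintro ⟨a, b, _⟩; exact h ⟨a, b⟩
  · intro y _ hy
    rw [if_neg, zero_mul]
    rintro ⟨_, _, c, d, e⟩
    apply hy
    ext1 u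
    by_cases h1 : u = j
    · subst h1; simp [d]
    · by_cases h2 : u = i
      · subst h2; simp [h1, c]
      · simp [h1, h2, e u h2 h1]
  · simp

open scoped Classical in
theorem xyHam_mulVec (A : Matrix V V ℂ) (f : (V → Fin 2) → ℂ) (s : V → Fin 2) :
    (xyHam A).mulVec f s = ∑ i, if s i = 1 then
      ((∑ j, if i ≠ j ∧ A i j = 1 ∧ s j = 0 then
        f (Function.update (Function.update s i 0) j 1) else 0)
        + if A i i = 1 then f s else 0) else 0 := by
  unfold xyHam
  rw [add_mulVec, Pi.add_apply, sum_mulVec, Finset.sum_apply, Fintype.sum_prod_type]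
  have h2 : ((Matrix.of fun x y : V → Fin 2 =>
        if x = y then
          ((Finset.univ.filter fun i : V => A i i = 1 ∧ x i = 1).card : ℂ)
        else 0).mulVec f) s = ∑ i, if s i = 1 then (if A i i = 1 then f s else 0) else 0 := by
    simp only [mulVec, dotProduct, of_apply, ite_mul, zero_mul, Finset.sum_ite_eq,
      Finset.mem_univ, if_true]
    rw [Finset.card_filter]
    push_cast
    rw [Finset.sum_mul]
    refine Finset.sum_congr rfl fun i _ => ?_
    by_cases h1 : s i = 1 <;> by_cases h2 : A i i = 1 <;> simp [h1, h2]
  rw [h2, ← Finset.sum_add_distrib]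
  refine Finset.sum_congr rfl fun i _ => ?_
  have : ∀ j ∈ (Finset.univ : Finset V),
      ((if i ≠ j ∧ A i j = 1 then xyHop V i j else 0).mulVec f s)
      = if s i = 1 then (if i ≠ j ∧ A i j = 1 ∧ s j = 0 then
        f (Function.update (Function.update s i 0) j 1) else 0) else 0 := by
    intro j _
    by_cases hij : i = j
    · simp [hij]
    · by_cases hA : A i j = 1
      · simp only [ne_eq, hij, not_false_eq_true, hA, and_self, if_true, true_and]
        rw [xyHop_mulVec i j hij]
        by_cases h1 : s i = 1 <;> simp [h1]
      · simp [hA]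
  rw [Finset.sum_congr rfl this]
  by_cases h1 : s i = 1 <;> simp [h1]

theorem inj_update {N : ℕ} (x : Fin N → V) (hx : Function.Injective x) (w : Fin N) (v : V) :
    Function.Injective (Function.update x w v) ↔ v = x w ∨ occ x v = 0 := by
  rw [occ_eq_zero]
  constructor
  · intro h
    by_contra! hc
    obtain ⟨h1, u, hu⟩ := hc
    have huw : u ≠ w := by rintro rfl; exact h1 hu.symm
    exact huw (h (by simp [huw, hu]))
  · rintro (rfl | h)
    · simpa using hx
    · intro a b hab
      by_cases ha : a = w <;> by_cases hb : b = w
      · rw [ha, hb]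
      · subst ha; simp [hb] at hab; exact absurd hab.symm (h b)
      · subst hb; simp [ha] at hab; exact absurd hab (h a)
      · simp [ha, hb] at hab; exact hx hab

theorem occ_update {N : ℕ} (x : Fin N → V) (hx : Function.Injective x) (w : Fin N) (v : V)
    (hv : occ x v = 0) :
    occ (Function.update x w v) = Function.update (Function.update (occ x) (x w) 0) v 1 := by
  rw [occ_eq_zero] at hv
  ext1 i
  by_cases h1 : i = v
  · subst h1
    rw [Function.update_self, occ_eq_one]; exact ⟨w, by simp⟩
  · rw [Function.update_of_ne h1]
    by_cases h2 : i = x w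
    · subst h2
      rw [Function.update_self, occ_eq_zero]
      intro u
      by_cases hu : u = w
      · subst hu; simpa using Ne.symm h1
      · simpa [hu] using fun h => hu (hx h)
    · rw [Function.update_of_ne h2]
      by_cases h3 : occ x i = 1
      · rw [h3]
        rw [occ_eq_one] at h3 ⊢
        obtain ⟨u, hu⟩ := h3
        have huw : u ≠ w := by rintro rfl; exact h2 hu.symm
        exact ⟨u, by simp [huw, hu]⟩
      · have h4 : occ x i = 0 := by omega
        rw [h4]
        rw [occ_eq_zero] at h4 ⊢
        intro u
        by_cases hu : u = w
        · subst hu; simpa using Ne.symm h1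
        · simpa [hu] using h4 u

open scoped Classical in
theorem key {N : ℕ} (A : Matrix V V ℂ) (h01 : ∀ i j, A i j = 0 ∨ A i j = 1)
    (f : (V → Fin 2) → ℂ) (x : Fin N → V) (hx : Function.Injective x) :
    (kin A N).mulVec (fun y => if Function.Injective y then f (occ y) else 0) x
      = (xyHam A).mulVec f (occ x) := by
  rw [xyHam_mulVec, ← Finset.sum_filter]
  have him : (Finset.univ.filter fun i => occ x i = 1) = Finset.univ.image x := by
    ext i; simp [occ_eq_one]
  rw [him, Finset.sum_image (fun a _ b _ h => hx h)]
  unfold kin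
  rw [sum_mulVec, Finset.sum_apply]
  refine Finset.sum_congr rfl fun w _ => ?_
  rw [onFactor_mulVec]
  have hd : (if A (x w) (x w) = 1 then f (occ x) else 0)
      = ∑ v, if v = x w then A (x w) v * f (occ x) else 0 := by
    rw [Finset.sum_ite_eq' Finset.univ (x w)]
    rcases h01 (x w) (x w) with h | h <;> simp [h]
  rw [hd, ← Finset.sum_add_distrib]
  refine Finset.sum_congr rfl fun v _ => ?_
  rw [if_congr (inj_update x hx w v) rfl rfl]
  by_cases h1 : v = x w
  · subst h1; simp
  · by_cases h2 : occ x v = 0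
    · rw [occ_update x hx w v h2]
      rcases h01 (x w) v with h | h <;> simp [h, h1, h2, Ne.symm h1]
    · simp [h1, h2]

open scoped Classical in
theorem theta_le {N : ℕ} (A : Matrix V V ℂ) (h01 : ∀ i j, A i j = 0 ∨ A i j = 1)
    (ψ : (Fin N → V) → ℂ) (hψ : ψ ∈ symmStates V N) :
    theta A N * nsq (fun y => if Function.Injective y then ψ y else 0)
      ≤ En (kin A N) (fun y => if Function.Injective y then ψ y else 0) := by
  obtain ⟨f, hf, hfψ⟩ := exists_f ψ hψ
  have e : (fun y => if Function.Injective y then ψ y else 0)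
      = fun y : Fin N → V => if Function.Injective y then f (occ y) else 0 := by
    ext y; split_ifs with h
    · exact hfψ y h
    · rfl
  have hf' : ∀ s : V → Fin 2, (Finset.univ.filter fun i => s i = 1).card ≠ N → f s = 0 := by
    intro s hs
    apply hf s
    convert hs
  have h := ground_le (xyHam A) (wtStates V N) (fun a v hv s hs => by simp [hv s hs]) f hf
  change theta A N * _ ≤ _ at h
  rw [e]
  have h1 : nsq (fun y : Fin N → V => if Function.Injective y then f (occ y) else 0)
      = N.factorial * nsq f := by
    unfold nsq
    rw [← sum_inj (fun s => ‖f s‖ ^ 2) (fun s hs => by simp [hf' s hs])]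
    refine Finset.sum_congr rfl fun y _ => ?_
    by_cases hy : Function.Injective y <;> simp [hy]
  have h2 : En (kin A N) (fun y : Fin N → V => if Function.Injective y then f (occ y) else 0)
      = N.factorial * En (xyHam A) f := by
    unfold En
    have := sum_inj (N := N) (fun s => star (f s) * (xyHam A).mulVec f s)
      (fun s hs => by simp [hf' s hs])
    have e2 : dotProduct (star fun y : Fin N → V => if Function.Injective y then f (occ y) else 0)
        ((kin A N).mulVec (fun y : Fin N → V => if Function.Injective y then f (occ y) else 0))
        = (N.factorial : ℂ) * dotProduct (star f) ((xyHam A).mulVec f) := by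
      simp only [dotProduct, Pi.star_apply]
      rw [← this]
      refine Finset.sum_congr rfl fun y _ => ?_
      by_cases hy : Function.Injective y
      · rw [key A h01 f y hy]; simp [hy]
      · simp [hy]
    rw [e2]
    rw [← Complex.ofReal_natCast, Complex.re_ofReal_mul]
  rw [h1, h2]
  calc _ = (N.factorial : ℝ) * (theta A N * nsq f) := by ring
    _ ≤ _ := by gcongr

open scoped Classical in
theorem main_ineq {N : ℕ} (A : Matrix V V ℂ) [Nonempty V]
    (h01 : ∀ i j, A i j = 0 ∨ A i j = 1) (hNK : N ≤ Fintype.card V)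
    (ψ : (Fin N → V) → ℂ) (hψ : ψ ∈ symmStates V N) (hn : nsq ψ = 1)
    (hδ : 0 < theta A N - N * mu A) :
    (theta A N - N * mu A) * (1 - En (bhHam A N - ((N : ℂ) * (mu A : ℂ)) • 1) ψ / 2)
      ≤ ((Fintype.card V : ℝ) ^ 2 + 1) * En (bhHam A N - ((N : ℂ) * (mu A : ℂ)) • 1) ψ := by
  have hA : ∀ i j, ‖A i j‖ ≤ 1 := fun i j => by rcases h01 i j with h | h <;> simp [h]
  have hcast : ((N : ℂ) * (mu A : ℂ)) = ((N * mu A : ℝ) : ℂ) := by push_cast; rfl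
  rw [hcast]
  set T := kin A N - ((N * mu A : ℝ) : ℂ) • (1 : Matrix (Fin N → V) (Fin N → V) ℂ) with hT
  have hTE : ∀ v, En T v = En (kin A N) v - N * mu A * nsq v := fun v => En_sub_smul _ _ _
  have hT0 : ∀ v, 0 ≤ En T v := fun v => by
    rw [hTE]; linarith [kin_lower A N v]
  have hr : En (bhHam A N - ((N * mu A : ℝ) : ℂ) • 1) ψ
      = En T ψ + En (interaction V N) ψ := by
    rw [hTE, En_sub_smul]
    have : bhHam A N = kin A N + interaction V N := rfl
    rw [this, En_add]; ring
  rw [hr]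
  set φ : (Fin N → V) → ℂ := fun y => if Function.Injective y then ψ y else 0 with hφ
  set χ : (Fin N → V) → ℂ := fun y => if Function.Injective y then 0 else ψ y with hχ
  have hsub : φ = ψ - χ := by
    ext y; simp only [hφ, hχ, Pi.sub_apply]; split_ifs <;> simp
  have hnn : nsq φ = 1 - nsq χ := by
    rw [← hn, eq_sub_iff_add_eq]
    unfold nsq
    rw [← Finset.sum_add_distrib]
    refine Finset.sum_congr rfl fun y _ => ?_
    simp only [hφ, hχ]; split_ifs <;> simp
  have hU : 2 * nsq χ ≤ En (interaction V N) ψ := by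
    rw [En_interaction]
    unfold nsq
    rw [Finset.mul_sum]
    refine Finset.sum_le_sum fun y _ => ?_
    simp only [hχ]
    split_ifs with h
    · simp; positivity
    · gcongr
      exact_mod_cast two_le_card N y h
  have hth := theta_le A h01 ψ hψ
  rw [← hφ] at hth
  set K : ℝ := (Fintype.card V : ℝ) with hK
  have hK1 : 1 ≤ K := by
    have : 1 ≤ Fintype.card V := Fintype.card_pos
    rw [hK]; exact_mod_cast this
  have hNK' : (N : ℝ) ≤ K := by rw [hK]; exact_mod_cast hNK
  have hχT : En T χ ≤ K ^ 2 * En (interaction V N) ψ := by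
    rw [hTE]
    have h1 := kin_upper A hA N χ
    have h2 := mu_lower A hA
    have h0 := nsq_nonneg χ
    have hN0 : (0 : ℝ) ≤ N := by positivity
    have h3 : (N : ℝ) * -K * nsq χ ≤ N * mu A * nsq χ := by gcongr
    calc En (kin A N) χ - N * mu A * nsq χ ≤ N * K * (2 * nsq χ) := by
          rw [← hK] at h1
          linarith
      _ ≤ K * K * (2 * nsq χ) := by gcongr
      _ ≤ K ^ 2 * En (interaction V N) ψ := by rw [← sq]; gcongr
  have hmain := En_sub_le T hT0 ψ χ (K ^ 2) (by positivity)
  rw [← hsub] at hmain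
  have h5 : (1 + 1 / K ^ 2) * En T χ ≤ (1 + K ^ 2) * En (interaction V N) ψ := by
    calc _ ≤ (1 + 1 / K ^ 2) * (K ^ 2 * En (interaction V N) ψ) := by gcongr
      _ = _ := by field_simp; ring
  have h6 : (theta A N - N * mu A) * nsq φ ≤ En T φ := by rw [hTE]; linarith
  have h7 : 1 - (En T ψ + En (interaction V N) ψ) / 2 ≤ nsq φ := by
    rw [hnn]; linarith [hT0 ψ]
  calc _ ≤ (theta A N - N * mu A) * nsq φ := by gcongr
    _ ≤ _ := by linarith

end BH

/-- Let `G` be a graph with `K` vertices (given by a symmetric 0-1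
adjacency matrix) and let `1 ≤ N ≤ K`.  If `0 < λ_N^1(G) < 1`, then
`θ_N(G) − Nμ(G) ≤ λ_N^1(G)·2(K²+1)/(2 − λ_N^1(G))`; in particular,
`θ_N(G) − Nμ(G) ≤ 4K²·λ_N^1(G)`. -/
theorem xy_close_to_frustration_free
    {V : Type*} [Fintype V] [DecidableEq V] [Nonempty V]
    (A : Matrix V V ℂ) (hsymm : A.IsSymm)
    (h01 : ∀ i j, A i j = 0 ∨ A i j = 1)
    (N : ℕ) (hN1 : 1 ≤ N) (hNK : N ≤ Fintype.card V)
    (hpos : 0 < BH.lambda1 A N) (hlt : BH.lambda1 A N < 1) :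
    BH.theta A N - N * BH.mu A
        ≤ BH.lambda1 A N * (2 * ((Fintype.card V : ℝ) ^ 2 + 1)) / (2 - BH.lambda1 A N)
      ∧ BH.theta A N - N * BH.mu A
        ≤ 4 * (Fintype.card V : ℝ) ^ 2 * BH.lambda1 A N := by
  have hfst : BH.theta A N - N * BH.mu A
        ≤ BH.lambda1 A N * (2 * ((Fintype.card V : ℝ) ^ 2 + 1)) / (2 - BH.lambda1 A N) := by
    rw [le_div_iff₀ (by linarith)]
    by_cases hδ : 0 < BH.theta A N - N * BH.mu A
    · set δ := BH.theta A N - N * BH.mu A with hd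
      set C := (Fintype.card V : ℝ) ^ 2 + 1 with hC
      have hC0 : 0 < C := by positivity
      have hle : δ / (C + δ / 2) ≤ BH.lambda1 A N := by
        unfold BH.lambda1 BH.groundEnergy
        apply le_csInf
        · by_contra hne
          rw [Set.not_nonempty_iff_eq_empty] at hne
          unfold BH.lambda1 BH.groundEnergy at hpos
          rw [hne, Real.sInf_empty] at hpos
          exact lt_irrefl _ hpos
        · rintro r ⟨ψ, hψ, hn, rfl⟩
          have e : BH.nsq ψ = 1 := by rw [BH.dot_self] at hn; exact_mod_cast hn
          have h := BH.main_ineq A h01 hNK ψ hψ e hδ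
          rw [div_le_iff₀ (by positivity)]
          unfold BH.En at h
          linarith
      rw [div_le_iff₀ (by positivity)] at hle
      linarith
    · have : (BH.theta A N - N * BH.mu A) * (2 - BH.lambda1 A N) ≤ 0 :=
        mul_nonpos_of_nonpos_of_nonneg (not_lt.1 hδ) (by linarith)
      refine this.trans (by positivity)
  refine ⟨hfst, hfst.trans ?_⟩
  rw [div_le_iff₀ (by linarith)]
  have hK1 : (1 : ℝ) ≤ (Fintype.card V : ℝ) := by
    have : 1 ≤ Fintype.card V := Fintype.card_pos
    exact_mod_cast this
  have hK2 : (1 : ℝ) ≤ (Fintype.card V : ℝ) ^ 2 := one_le_pow₀ hK1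
  set L := BH.lambda1 A N
  set Q := (Fintype.card V : ℝ) ^ 2
  have h1 : L * (2 * (Q + 1)) ≤ L * (4 * Q) :=
    mul_le_mul_of_nonneg_left (by linarith) hpos.le
  have h2 : 4 * Q * L * 1 ≤ 4 * Q * L * (2 - L) := by gcongr; linarith
  linarith
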